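/- In Mat_P(ℂ) the identity L·R = q·F+·F− + (q−1)^{−1}·((q^{n/2+1}·K1^{−1}·K2 − q^{(n−k)/2+1}·K2)·F+ + (q^{n/2+1}·K1·K2^{−1} − q^{k/2+1}·K1)·F−) + (q−1)^{−2}·(q^{n/2+1}·K1·K2 − q^{n−(k/2)+1}·K1 − q^{(n+k)/2+1}·K2 + q^{n+1}·I) holds. -/

import Mathlib

open scoped Classical

noncomputable section

variable {F V : Type} [Field F] [AddCommGroup V] [Module F V]

/-- `v` covers `u` in the projective geometry `P`. -/
def Covers (u v : Submodule F V) : Prop :=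
  u ≤ v ∧ Module.finrank F ↥v = Module.finrank F ↥u + 1

/-- `v` slash-covers `u` (relative to the fixed subspace `y`). -/
def SlashCovers (y u v : Submodule F V) : Prop :=
  Covers u v ∧ Module.finrank F ↥(v ⊓ y) = Module.finrank F ↥(u ⊓ y) + 1

/-- `v` backslash-covers `u` (relative to the fixed subspace `y`). -/
def BackslashCovers (y u v : Submodule F V) : Prop :=
  Covers u v ∧ Module.finrank F ↥(v ⊓ y) = Module.finrank F ↥(u ⊓ y)

/-- `q` raised to a real exponent, as a complex number. -/
def qpow (q : ℕ) (e : ℝ) : ℂ := (((q : ℝ) ^ e : ℝ) : ℂ)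

/-- The Gaussian bracket `[m] = (q^m - 1)/(q - 1)` as a rational number. -/
def gaussQ (q m : ℕ) : ℚ := ((q : ℚ) ^ m - 1) / ((q : ℚ) - 1)

/-- The Gaussian bracket `[m] = (q^m - 1)/(q - 1)` as a complex number. -/
def gaussC (q m : ℕ) : ℂ := ((q : ℂ) ^ m - 1) / ((q : ℂ) - 1)

/-- The diagonal matrix `K1`; the `(u,u)` entry is `q^(k/2 - i)` for `u ∈ P_{i,j}`. -/
def matK1 (q k : ℕ) (y : Submodule F V) : Matrix (Submodule F V) (Submodule F V) ℂ :=
  Matrix.diagonal fun u => qpow q ((k : ℝ) / 2 - (Module.finrank F ↥(u ⊓ y) : ℝ))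

/-- The diagonal matrix `K2`; the `(u,u)` entry is `q^(j - (n-k)/2)` for `u ∈ P_{i,j}`. -/
def matK2 (q n k : ℕ) (y : Submodule F V) : Matrix (Submodule F V) (Submodule F V) ℂ :=
  Matrix.diagonal fun u =>
    qpow q (((Module.finrank F ↥u : ℝ) - (Module.finrank F ↥(u ⊓ y) : ℝ))
      - ((n : ℝ) - (k : ℝ)) / 2)

/-- The 0-1 matrix `L1`; the `(u,v)` entry is `1` iff `v` slash-covers `u`. -/
def matL1 (y : Submodule F V) : Matrix (Submodule F V) (Submodule F V) ℂ :=
  Matrix.of fun u v => if SlashCovers y u v then (1 : ℂ) else 0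

/-- The 0-1 matrix `L2`; the `(u,v)` entry is `1` iff `v` backslash-covers `u`. -/
def matL2 (y : Submodule F V) : Matrix (Submodule F V) (Submodule F V) ℂ :=
  Matrix.of fun u v => if BackslashCovers y u v then (1 : ℂ) else 0

/-- `R1 = L1ᵀ`. -/
def matR1 (y : Submodule F V) : Matrix (Submodule F V) (Submodule F V) ℂ := Matrix.transpose (matL1 y)

/-- `R2 = L2ᵀ`. -/
def matR2 (y : Submodule F V) : Matrix (Submodule F V) (Submodule F V) ℂ := Matrix.transpose (matL2 y)

/-- `R = L1 · R2`. -/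
def matR [Fintype (Submodule F V)] (y : Submodule F V) :
    Matrix (Submodule F V) (Submodule F V) ℂ := matL1 y * matR2 y

/-- `L = R1 · L2`. -/
def matL [Fintype (Submodule F V)] (y : Submodule F V) :
    Matrix (Submodule F V) (Submodule F V) ℂ := matR1 y * matL2 y

/-- The 0-1 matrix `F0`. -/
def matF0 (y : Submodule F V) : Matrix (Submodule F V) (Submodule F V) ℂ :=
  Matrix.of fun u v =>
    if SlashCovers y u (u ⊔ v) ∧ SlashCovers y v (u ⊔ v) ∧
        BackslashCovers y (u ⊓ v) u ∧ BackslashCovers y (u ⊓ v) v then (1 : ℂ) else 0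

/-- The 0-1 matrix `F+`. -/
def matFp (y : Submodule F V) : Matrix (Submodule F V) (Submodule F V) ℂ :=
  Matrix.of fun u v =>
    if BackslashCovers y u (u ⊔ v) ∧ BackslashCovers y v (u ⊔ v) then (1 : ℂ) else 0

/-- The 0-1 matrix `F-`. -/
def matFm (y : Submodule F V) : Matrix (Submodule F V) (Submodule F V) ℂ :=
  Matrix.of fun u v =>
    if SlashCovers y (u ⊓ v) u ∧ SlashCovers y (u ⊓ v) v then (1 : ℂ) else 0

/-- The vertex set `X` of the Grassmann graph: `k`-dimensional subspaces of `V`. -/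
abbrev GrassVertex (F V : Type) [Field F] [AddCommGroup V] [Module F V] (k : ℕ) :=
  {z : Submodule F V // Module.finrank F ↥z = k}

/-- The Grassmann graph `J_q(n,k)`: vertices are adjacent iff their intersection
has dimension `k - 1`. -/
def Grass (F V : Type) [Field F] [AddCommGroup V] [Module F V] (k : ℕ) :
    SimpleGraph (GrassVertex F V k) :=
  SimpleGraph.fromRel fun a b => Module.finrank F ↥(a.1 ⊓ b.1) = k - 1

/-- `B_xy = {z ∈ Γ(x) : ∂(z,y) = ∂(x,y) + 1}`. -/
def Bset {k : ℕ} (x y : GrassVertex F V k) : Set (GrassVertex F V k) :=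
  {z | (Grass F V k).Adj x z ∧ (Grass F V k).dist z y = (Grass F V k).dist x y + 1}

/-- `C_xy = {z ∈ Γ(x) : ∂(z,y) = ∂(x,y) - 1}`. -/
def Cset {k : ℕ} (x y : GrassVertex F V k) : Set (GrassVertex F V k) :=
  {z | (Grass F V k).Adj x z ∧ (Grass F V k).dist z y = (Grass F V k).dist x y - 1}

/-- `A_xy = {z ∈ Γ(x) : ∂(z,y) = ∂(x,y)}`. -/
def Aset {k : ℕ} (x y : GrassVertex F V k) : Set (GrassVertex F V k) :=
  {z | (Grass F V k).Adj x z ∧ (Grass F V k).dist z y = (Grass F V k).dist x y}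

/-- `A0_xy`. -/
def A0set {k : ℕ} (x y : GrassVertex F V k) : Set (GrassVertex F V k) :=
  {z | (Grass F V k).Adj x z ∧
    SlashCovers y.1 z.1 (z.1 ⊔ x.1) ∧ SlashCovers y.1 x.1 (z.1 ⊔ x.1) ∧
    BackslashCovers y.1 (z.1 ⊓ x.1) z.1 ∧ BackslashCovers y.1 (z.1 ⊓ x.1) x.1}

/-- `A+_xy`. -/
def Apset {k : ℕ} (x y : GrassVertex F V k) : Set (GrassVertex F V k) :=
  {z | (Grass F V k).Adj x z ∧
    BackslashCovers y.1 z.1 (z.1 ⊔ x.1) ∧ BackslashCovers y.1 x.1 (z.1 ⊔ x.1)}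

/-- `A-_xy`. -/
def Amset {k : ℕ} (x y : GrassVertex F V k) : Set (GrassVertex F V k) :=
  {z | (Grass F V k).Adj x z ∧
    SlashCovers y.1 (z.1 ⊓ x.1) z.1 ∧ SlashCovers y.1 (z.1 ⊓ x.1) x.1}

/-- The edge `wz` has type `0`. -/
def EdgeType0 {k : ℕ} (y w z : GrassVertex F V k) : Prop :=
  SlashCovers y.1 w.1 (w.1 ⊔ z.1) ∧ SlashCovers y.1 z.1 (w.1 ⊔ z.1) ∧
  BackslashCovers y.1 (w.1 ⊓ z.1) w.1 ∧ BackslashCovers y.1 (w.1 ⊓ z.1) z.1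

/-- The edge `wz` has type `+`. -/
def EdgeTypeP {k : ℕ} (y w z : GrassVertex F V k) : Prop :=
  BackslashCovers y.1 w.1 (w.1 ⊔ z.1) ∧ BackslashCovers y.1 z.1 (w.1 ⊔ z.1)

/-- The edge `wz` has type `-`. -/
def EdgeTypeM {k : ℕ} (y w z : GrassVertex F V k) : Prop :=
  SlashCovers y.1 (w.1 ⊓ z.1) w.1 ∧ SlashCovers y.1 (w.1 ⊓ z.1) z.1

lemma finrank_sup_span_singleton_of_notMem [FiniteDimensional F V] {u : Submodule F V} {x : V}
    (hx : x ∉ u) :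
    Module.finrank F ↥(u ⊔ Submodule.span F {x}) = Module.finrank F ↥u + 1 := by
  have hx0 : x ≠ 0 := fun h => hx (h ▸ u.zero_mem)
  have hdisj : u ⊓ Submodule.span F {x} = ⊥ :=
    disjoint_iff.mp ((Submodule.disjoint_span_singleton' hx0).mpr hx)
  have h := Submodule.finrank_sup_add_finrank_inf_eq u (Submodule.span F {x})
  rw [hdisj, finrank_bot, finrank_span_singleton hx0] at h
  exact h

lemma covers_sup_span_singleton [FiniteDimensional F V] {u : Submodule F V} {x : V}
    (hx : x ∉ u) : Covers u (u ⊔ Submodule.span F {x}) :=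
  ⟨le_sup_left, finrank_sup_span_singleton_of_notMem hx⟩

/-- There is nothing strictly between the two members of a covering pair. -/
lemma Covers.eq_or_eq [FiniteDimensional F V] {u v w : Submodule F V} (h : Covers u v)
    (huw : u ≤ w) (hwv : w ≤ v) : w = u ∨ w = v := by
  have h1 := Submodule.finrank_mono huw
  have h2 := Submodule.finrank_mono hwv
  have h3 := h.2
  rcases Nat.lt_or_ge (Module.finrank F ↥u) (Module.finrank F ↥w) with h4 | h4
  · exact Or.inr (Submodule.eq_of_le_of_finrank_eq hwv (by omega))
  · exact Or.inl (Submodule.eq_of_le_of_finrank_eq huw (by omega)).symm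

lemma backslashCovers_iff [FiniteDimensional F V] {y u v : Submodule F V} :
    BackslashCovers y u v ↔ Covers u v ∧ v ⊓ y ≤ u := by
  refine and_congr_right fun h => ⟨fun h1 => ?_, fun h1 => ?_⟩
  · have := Submodule.eq_of_le_of_finrank_eq (inf_le_inf_right y h.1) h1.symm
    exact this ▸ inf_le_left
  · rw [le_antisymm (le_inf h1 inf_le_right) (inf_le_inf_right y h.1)]

lemma Covers.finrank_inf_le [FiniteDimensional F V] {u v : Submodule F V} (h : Covers u v)
    (y : Submodule F V) :
    Module.finrank F ↥(v ⊓ y) ≤ Module.finrank F ↥(u ⊓ y) + 1 := by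
  have h1 := Submodule.finrank_sup_add_finrank_inf_eq (v ⊓ y) u
  have h2 : v ⊓ y ⊓ u = u ⊓ y := by rw [inf_right_comm, inf_eq_right.mpr h.1]
  have h3 := Submodule.finrank_mono (sup_le inf_le_left h.1 : v ⊓ y ⊔ u ≤ v)
  have h4 := h.2
  rw [h2] at h1
  omega

lemma slashCovers_iff [FiniteDimensional F V] {y u v : Submodule F V} :
    SlashCovers y u v ↔ Covers u v ∧ ¬ v ⊓ y ≤ u := by
  refine and_congr_right fun h => ⟨fun h1 h2 => ?_, fun h1 => ?_⟩
  · have := (backslashCovers_iff.mpr ⟨h, h2⟩).2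
    omega
  · have h3 : ¬ Module.finrank F ↥(v ⊓ y) = Module.finrank F ↥(u ⊓ y) :=
      fun h3 => h1 (backslashCovers_iff.mp ⟨h, h3⟩).2
    have h4 := Submodule.finrank_mono (inf_le_inf_right y h.1)
    have h5 := h.finrank_inf_le y
    omega

lemma Covers.inf_le_iff [FiniteDimensional F V] {y u v w : Submodule F V} (h : Covers u w)
    (hwv : w ≤ v) : w ⊓ y ≤ u ↔ ¬ w ≤ u ⊔ v ⊓ y := by
  have hne : u ≠ w := fun h1 => by
    have := h.2
    rw [h1] at this
    omega
  constructor
  · intro h1 h2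
    have h3 : w = u ⊔ w ⊓ y := by
      conv_lhs => rw [← inf_eq_right.mpr h2, sup_inf_assoc_of_le _ h.1]
      rw [inf_right_comm, inf_eq_right.mpr hwv]
    rw [sup_eq_left.mpr h1] at h3
    exact hne h3.symm
  · intro h1
    rcases h.eq_or_eq (le_sup_left : u ≤ u ⊔ w ⊓ y) (sup_le h.1 inf_le_left) with h2 | h2
    · exact sup_eq_left.mp h2
    · exact absurd (h2 ▸ sup_le_sup_left (inf_le_inf_right y hwv) u) h1

/-- The number of covers of `u` inside `v` that are not contained in `s`, where `u ≤ s ≤ v`. -/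
lemma ncard_covers_not_le [Fintype F] [FiniteDimensional F V] {u s v : Submodule F V}
    (hus : u ≤ s) (hsv : s ≤ v) :
    ({w | Covers u w ∧ w ≤ v ∧ ¬ w ≤ s} : Set (Submodule F V)).ncard *
      (Fintype.card F ^ (Module.finrank F ↥u + 1) - Fintype.card F ^ Module.finrank F ↥u) =
      Fintype.card F ^ Module.finrank F ↥v - Fintype.card F ^ Module.finrank F ↥s := by
  have : Finite V := Module.finite_of_finite F
  have : Fintype V := Fintype.ofFinite V
  have : Fintype (Submodule F V) := Fintype.ofFinite _
  have hsdiff : ∀ a b : Submodule F V, a ≤ b → ((b : Set V) \ a).ncard =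
      Fintype.card F ^ Module.finrank F ↥b - Fintype.card F ^ Module.finrank F ↥a := by
    intro a b hab
    have hc : ∀ c : Submodule F V, (c : Set V).ncard = Fintype.card F ^ Module.finrank F ↥c :=
      fun c => by
        rw [← Nat.card_coe_set_eq, ← Nat.card_eq_fintype_card]
        exact Module.natCard_eq_pow_finrank
    rw [Set.ncard_sdiff (show (a : Set V) ⊆ b from hab) (Set.toFinite _), hc, hc]
  rw [← hsdiff s v hsv, Set.ncard_eq_toFinset_card', Set.ncard_eq_toFinset_card',
    Finset.card_eq_sum_card_fiberwise (f := fun x => u ⊔ Submodule.span F {x})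
      (t := ({w | Covers u w ∧ w ≤ v ∧ ¬ w ≤ s} : Set (Submodule F V)).toFinset),
    Finset.sum_congr rfl, Finset.sum_const, smul_eq_mul]
  · intro w hw
    simp only [Set.mem_toFinset, Set.mem_ofPred_eq] at hw
    obtain ⟨hw, hwv, hws⟩ := hw
    rw [← hw.2, ← hsdiff u w hw.1, Set.ncard_eq_toFinset_card']
    congr 1
    ext x
    simp only [Finset.mem_filter, Set.mem_toFinset, Set.mem_sdiff, SetLike.mem_coe]
    constructor
    · rintro ⟨⟨-, hxs⟩, rfl⟩
      exact ⟨Submodule.mem_sup_right (Submodule.mem_span_singleton_self x),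
        fun h => hxs (hus h)⟩
    · rintro ⟨hxw, hxu⟩
      have h1 : u ⊔ Submodule.span F {x} = w :=
        Submodule.eq_of_le_of_finrank_eq
          (sup_le hw.1 ((Submodule.span_singleton_le_iff_mem x w).mpr hxw))
          ((finrank_sup_span_singleton_of_notMem hxu).trans hw.2.symm)
      refine ⟨⟨hwv hxw, fun hxs => hws ?_⟩, h1⟩
      rw [← h1]
      exact sup_le hus ((Submodule.span_singleton_le_iff_mem x s).mpr hxs)
  · intro x hx
    simp only [Set.coe_toFinset, Set.mem_sdiff, SetLike.mem_coe] at hx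
    simp only [Set.coe_toFinset, Set.mem_ofPred_eq]
    exact ⟨covers_sup_span_singleton fun h => hx.2 (hus h),
      sup_le (hus.trans hsv) ((Submodule.span_singleton_le_iff_mem x v).mpr hx.1),
      fun h => hx.2 (h (Submodule.mem_sup_right (Submodule.mem_span_singleton_self x)))⟩

lemma Covers.eq_inf [FiniteDimensional F V] {a u v : Submodule F V} (hu : Covers a u)
    (hv : Covers a v) (hne : u ≠ v) : a = u ⊓ v := by
  rcases hu.eq_or_eq (le_inf hu.1 hv.1) inf_le_left with h | h
  · exact h.symm
  · exact absurd (Submodule.eq_of_le_of_finrank_eq (inf_eq_left.mp h) (hu.2.trans hv.2.symm)) hne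

lemma Covers.eq_sup [FiniteDimensional F V] {b u v : Submodule F V} (hu : Covers u b)
    (hv : Covers v b) (hne : u ≠ v) : b = u ⊔ v := by
  rcases hu.eq_or_eq le_sup_left (sup_le hu.1 hv.1) with h | h
  · have h1 := hu.2
    have h2 := hv.2
    exact absurd (Submodule.eq_of_le_of_finrank_eq (sup_eq_left.mp h) (by omega)).symm hne
  · exact h.symm

lemma slashCovers_inf_and_backslashCovers_inf_iff [FiniteDimensional F V]
    {y u v : Submodule F V} :
    SlashCovers y (u ⊓ v) u ∧ BackslashCovers y (u ⊓ v) v ↔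
      BackslashCovers y u (u ⊔ v) ∧ SlashCovers y v (u ⊔ v) := by
  have h1 := Submodule.finrank_sup_add_finrank_inf_eq u v
  have h2 := Submodule.finrank_sup_add_finrank_inf_eq (u ⊓ y) (v ⊓ y)
  rw [← inf_inf_distrib_right] at h2
  have h3 : Module.finrank F ↥(u ⊓ y ⊔ v ⊓ y) ≤ Module.finrank F ↥((u ⊔ v) ⊓ y) :=
    Submodule.finrank_mono (sup_le (inf_le_inf_right y le_sup_left)
      (inf_le_inf_right y le_sup_right))
  have h4 : Module.finrank F ↥(u ⊓ v ⊓ y) ≤ Module.finrank F ↥(v ⊓ y) :=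
    Submodule.finrank_mono (inf_le_inf_right y inf_le_right)
  have h5 : Module.finrank F ↥(v ⊓ y) ≤ Module.finrank F ↥((u ⊔ v) ⊓ y) :=
    Submodule.finrank_mono (inf_le_inf_right y le_sup_right)
  constructor
  · rintro ⟨⟨⟨-, ha⟩, hb⟩, ⟨-, hc⟩, hd⟩
    have hv : Covers v (u ⊔ v) := ⟨le_sup_right, by omega⟩
    have h6 := hv.finrank_inf_le y
    exact ⟨⟨⟨le_sup_left, by omega⟩, by omega⟩, hv, by omega⟩
  · rintro ⟨⟨⟨-, ha⟩, hb⟩, ⟨-, hc⟩, hd⟩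
    exact ⟨⟨⟨inf_le_left, by omega⟩, by omega⟩, ⟨inf_le_right, by omega⟩, by omega⟩

lemma sum_ite_mul_ite_eq_ncard {α : Type} [Fintype α] (p r : α → Prop) :
    ∑ w, (if p w then (1 : ℂ) else 0) * (if r w then (1 : ℂ) else 0) =
      ((({w | p w ∧ r w} : Set α).ncard : ℕ) : ℂ) := by
  rw [Set.ncard_eq_toFinset_card', Set.toFinset_ofPred, Finset.card_filter, Nat.cast_sum]
  refine Finset.sum_congr rfl fun w _ => ?_
  by_cases hp : p w <;> by_cases hr : r w <;> simp [hp, hr]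

lemma ncard_eq_ite_of_forall_eq {α : Type} {s : Set α} (a : α) (h : ∀ w ∈ s, w = a) :
    ((s.ncard : ℕ) : ℂ) = if a ∈ s then (1 : ℂ) else 0 := by
  split_ifs with ha
  · rw [show s = {a} from Set.eq_singleton_iff_unique_mem.mpr ⟨ha, h⟩]
    simp
  · rw [show s = ∅ from Set.eq_empty_of_forall_notMem fun w hw => ha (h w hw ▸ hw)]
    simp

section
variable [Fintype (Submodule F V)]

lemma matR1_mul_matL2_apply (y u v : Submodule F V) :
    (matR1 y * matL2 y) u v = ((({a | SlashCovers y a u ∧ BackslashCovers y a v} :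
      Set (Submodule F V)).ncard : ℕ) : ℂ) :=
  (Matrix.mul_apply).trans (sum_ite_mul_ite_eq_ncard _ _)

lemma matL2_mul_matR1_apply (y u v : Submodule F V) :
    (matL2 y * matR1 y) u v = ((({b | BackslashCovers y u b ∧ SlashCovers y v b} :
      Set (Submodule F V)).ncard : ℕ) : ℂ) :=
  (Matrix.mul_apply).trans (sum_ite_mul_ite_eq_ncard _ _)

lemma matL2_mul_matR2_apply (y u v : Submodule F V) :
    (matL2 y * matR2 y) u v = ((({b | BackslashCovers y u b ∧ BackslashCovers y v b} :
      Set (Submodule F V)).ncard : ℕ) : ℂ) :=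
  (Matrix.mul_apply).trans (sum_ite_mul_ite_eq_ncard _ _)

lemma matR1_mul_matL1_apply (y u v : Submodule F V) :
    (matR1 y * matL1 y) u v = ((({a | SlashCovers y a u ∧ SlashCovers y a v} :
      Set (Submodule F V)).ncard : ℕ) : ℂ) :=
  (Matrix.mul_apply).trans (sum_ite_mul_ite_eq_ncard _ _)

lemma matL2_mul_matL1_apply (y u v : Submodule F V) :
    (matL2 y * matL1 y) u v = ((({w | BackslashCovers y u w ∧ SlashCovers y w v} :
      Set (Submodule F V)).ncard : ℕ) : ℂ) :=
  (Matrix.mul_apply).trans (sum_ite_mul_ite_eq_ncard _ _)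

lemma matL1_mul_matL2_apply (y u v : Submodule F V) :
    (matL1 y * matL2 y) u v = ((({w | SlashCovers y u w ∧ BackslashCovers y w v} :
      Set (Submodule F V)).ncard : ℕ) : ℂ) :=
  (Matrix.mul_apply).trans (sum_ite_mul_ite_eq_ncard _ _)

lemma matR1_mul_matL2 [FiniteDimensional F V] (y : Submodule F V) :
    matR1 y * matL2 y = matL2 y * matR1 y := by
  ext u v
  rw [matR1_mul_matL2_apply, matL2_mul_matR1_apply,
    ncard_eq_ite_of_forall_eq (u ⊓ v), ncard_eq_ite_of_forall_eq (u ⊔ v)]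
  · simp only [Set.mem_ofPred_eq, slashCovers_inf_and_backslashCovers_inf_iff]
    congr
  · rintro b ⟨h1, h2⟩
    refine h1.1.eq_sup h2.1 fun h => ?_
    have h3 := h1.2
    have h4 := h2.2
    rw [h] at h3
    omega
  · rintro a ⟨h1, h2⟩
    refine h1.1.eq_inf h2.1 fun h => ?_
    have h3 := h1.2
    have h4 := h2.2
    rw [h] at h3
    omega

lemma matL1_mul_matR2 [FiniteDimensional F V] (y : Submodule F V) :
    matL1 y * matR2 y = matR2 y * matL1 y := by
  have h := congrArg Matrix.transpose (matR1_mul_matL2 y)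
  rw [Matrix.transpose_mul, Matrix.transpose_mul] at h
  exact h.symm

lemma matL2_mul_matL1 [Fintype F] [FiniteDimensional F V] (y : Submodule F V) :
    matL2 y * matL1 y = (Fintype.card F : ℂ) • (matL1 y * matL2 y) := by
  ext u v
  rw [Matrix.smul_apply, matL2_mul_matL1_apply, matL1_mul_matL2_apply]
  by_cases h : u ≤ v ∧ Module.finrank F ↥v = Module.finrank F ↥u + 2 ∧
      Module.finrank F ↥(v ⊓ y) = Module.finrank F ↥(u ⊓ y) + 1
  · obtain ⟨huv, hd, hi⟩ := h
    have hs : Module.finrank F ↥(u ⊔ v ⊓ y) = Module.finrank F ↥u + 1 := by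
      have h1 := Submodule.finrank_sup_add_finrank_inf_eq u (v ⊓ y)
      rw [← inf_assoc, inf_eq_left.mpr huv] at h1
      omega
    have hsv : u ⊔ v ⊓ y ≤ v := sup_le huv inf_le_left
    have h1 : ({w | BackslashCovers y u w ∧ SlashCovers y w v} : Set (Submodule F V)) =
        {w | Covers u w ∧ w ≤ v ∧ ¬ w ≤ u ⊔ v ⊓ y} := by
      ext w
      constructor
      · rintro ⟨ha, hb⟩
        exact ⟨ha.1, hb.1.1, (ha.1.inf_le_iff hb.1.1).mp (backslashCovers_iff.mp ha).2⟩
      · rintro ⟨ha, hb, hc⟩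
        have hd' := backslashCovers_iff.mpr ⟨ha, (ha.inf_le_iff hb).mpr hc⟩
        refine ⟨hd', ⟨hb, ?_⟩, ?_⟩
        · rw [hd, ha.2]
        · rw [hi, hd'.2]
    have h2 : ({w | SlashCovers y u w ∧ BackslashCovers y w v} : Set (Submodule F V)) =
        {u ⊔ v ⊓ y} := by
      refine Set.eq_singleton_iff_unique_mem.mpr ⟨?_, ?_⟩
      · have h3 : (u ⊔ v ⊓ y) ⊓ y = v ⊓ y :=
          le_antisymm (inf_le_inf_right y hsv) (le_inf le_sup_right inf_le_right)
        refine ⟨⟨⟨le_sup_left, hs⟩, ?_⟩, ⟨hsv, ?_⟩, ?_⟩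
        · rw [h3, hi]
        · rw [hd, hs]
        · rw [h3]
      · rintro w ⟨ha, hb⟩
        refine (Submodule.eq_of_le_of_finrank_eq
          (sup_le ha.1.1 (backslashCovers_iff.mp hb).2) ?_).symm
        rw [hs, ha.1.2]
    have h3 := ncard_covers_not_le (le_sup_left : u ≤ u ⊔ v ⊓ y) hsv
    rw [← h1, hd, hs] at h3
    have h4 : Fintype.card F ^ (Module.finrank F ↥u + 2) -
        Fintype.card F ^ (Module.finrank F ↥u + 1) = Fintype.card F *
        (Fintype.card F ^ (Module.finrank F ↥u + 1) -
          Fintype.card F ^ Module.finrank F ↥u) := by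
      rw [Nat.mul_sub]
      congr 1 <;> ring
    rw [h4] at h3
    have h5 : 0 < Fintype.card F ^ (Module.finrank F ↥u + 1) -
        Fintype.card F ^ Module.finrank F ↥u :=
      Nat.sub_pos_of_lt (Nat.pow_lt_pow_right Fintype.one_lt_card (Nat.lt_succ_self _))
    rw [Nat.eq_of_mul_eq_mul_right h5 h3, h2]
    simp
  · rw [show ({w | BackslashCovers y u w ∧ SlashCovers y w v} : Set (Submodule F V)) = ∅ from
        Set.eq_empty_of_forall_notMem ?_,
      show ({w | SlashCovers y u w ∧ BackslashCovers y w v} : Set (Submodule F V)) = ∅ from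
        Set.eq_empty_of_forall_notMem ?_]
    · simp
    · rintro w ⟨⟨⟨ha, hb⟩, hc⟩, ⟨hd, he⟩, hf⟩
      exact h ⟨ha.trans hd, by omega, by omega⟩
    · rintro w ⟨⟨⟨ha, hb⟩, hc⟩, ⟨hd, he⟩, hf⟩
      exact h ⟨ha.trans hd, by omega, by omega⟩

lemma matR1_mul_matR2 [Fintype F] [FiniteDimensional F V] (y : Submodule F V) :
    matR1 y * matR2 y = (Fintype.card F : ℂ) • (matR2 y * matR1 y) := by
  have h := congrArg Matrix.transpose (matL2_mul_matL1 y)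
  rw [Matrix.transpose_smul, Matrix.transpose_mul, Matrix.transpose_mul] at h
  exact h

lemma matL2_mul_matR2 [FiniteDimensional F V] (y : Submodule F V) :
    matL2 y * matR2 y = matFp y + Matrix.diagonal fun u =>
      ((({b | BackslashCovers y u b} : Set (Submodule F V)).ncard : ℕ) : ℂ) := by
  ext u v
  rw [matL2_mul_matR2_apply, Matrix.add_apply]
  by_cases h : u = v
  · subst h
    have h1 : ¬ BackslashCovers y u u := fun h => by
      have := h.1.2
      omega
    simp [matFp, h1]
  · rw [Matrix.diagonal_apply_ne _ h, add_zero, ncard_eq_ite_of_forall_eq (u ⊔ v)]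
    · simp only [matFp, Matrix.of_apply, Set.mem_ofPred_eq]
      congr
    · rintro b ⟨h1, h2⟩
      exact h1.1.eq_sup h2.1 h

lemma matR1_mul_matL1 [FiniteDimensional F V] (y : Submodule F V) :
    matR1 y * matL1 y = matFm y + Matrix.diagonal fun u =>
      ((({a | SlashCovers y a u} : Set (Submodule F V)).ncard : ℕ) : ℂ) := by
  ext u v
  rw [matR1_mul_matL1_apply, Matrix.add_apply]
  by_cases h : u = v
  · subst h
    have h1 : ¬ SlashCovers y u u := fun h => by
      have := h.1.2
      omega
    simp [matFm, h1]
  · rw [Matrix.diagonal_apply_ne _ h, add_zero, ncard_eq_ite_of_forall_eq (u ⊓ v)]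
    · simp only [matFm, Matrix.of_apply, Set.mem_ofPred_eq]
      congr
    · rintro b ⟨h1, h2⟩
      exact h1.1.eq_inf h2.1 h

/-- The product `L * R` in terms of the products `L2 * R2` and `R1 * L1`. -/
lemma matL_mul_matR [Fintype F] [FiniteDimensional F V] (y : Submodule F V) :
    matL y * matR y = (Fintype.card F : ℂ) • (matL2 y * matR2 y * (matR1 y * matL1 y)) := by
  rw [matL, matR, matR1_mul_matL2, matL1_mul_matR2, Matrix.mul_assoc,
    ← Matrix.mul_assoc (matR1 y), matR1_mul_matR2, Matrix.smul_mul, Matrix.mul_smul]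
  simp only [Matrix.mul_assoc]

end

lemma qpow_add {q : ℕ} (hq : 0 < q) (a b : ℝ) : qpow q (a + b) = qpow q a * qpow q b := by
  rw [qpow, Real.rpow_add (Nat.cast_pos.mpr hq), Complex.ofReal_mul]
  rfl

lemma qpow_natCast (q m : ℕ) : qpow q (m : ℝ) = (q : ℂ) ^ m := by
  simp [qpow]

lemma qpow_zero (q : ℕ) : qpow q 0 = 1 := by
  simp [qpow]

lemma ncard_backslashCovers_mul [Fintype F] [FiniteDimensional F V] (y u : Submodule F V) :
    ((({b | BackslashCovers y u b} : Set (Submodule F V)).ncard : ℕ) : ℂ) *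
      ((Fintype.card F : ℂ) - 1) =
      qpow (Fintype.card F) ((Module.finrank F V : ℝ) - Module.finrank F ↥u) -
        qpow (Fintype.card F) ((Module.finrank F ↥y : ℝ) - Module.finrank F ↥(u ⊓ y)) := by
  have hq : 1 < Fintype.card F := Fintype.one_lt_card
  have h1 := ncard_covers_not_le (le_sup_left : u ≤ u ⊔ y) le_top
  rw [show ({w | Covers u w ∧ w ≤ ⊤ ∧ ¬ w ≤ u ⊔ y} : Set (Submodule F V)) =
    {b | BackslashCovers y u b} from ?_, finrank_top] at h1
  · have h2 := Submodule.finrank_sup_add_finrank_inf_eq u y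
    have h3 := congrArg (Nat.cast : ℕ → ℂ) h1
    rw [Nat.cast_mul, Nat.cast_sub (Nat.pow_le_pow_right hq.le (Nat.le_add_right _ 1)),
      Nat.cast_sub (Nat.pow_le_pow_right hq.le (Submodule.finrank_le _))] at h3
    push_cast at h3
    have h4 : (Module.finrank F ↥y : ℝ) - Module.finrank F ↥(u ⊓ y) =
        Module.finrank F ↥(u ⊔ y) - Module.finrank F ↥u := by
      have : (Module.finrank F ↥(u ⊔ y) : ℝ) + Module.finrank F ↥(u ⊓ y) =
        Module.finrank F ↥u + Module.finrank F ↥y := by exact_mod_cast h2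
      linarith
    have h5 : (Fintype.card F : ℂ) ^ Module.finrank F ↥u ≠ 0 :=
      pow_ne_zero _ (Nat.cast_ne_zero.mpr (by omega))
    refine mul_right_cancel₀ h5 ?_
    rw [h4, sub_mul (qpow _ _), ← qpow_natCast, ← qpow_add (by omega), ← qpow_add (by omega),
      sub_add_cancel, sub_add_cancel, qpow_natCast, qpow_natCast, qpow_natCast, ← h3]
    ring
  · ext w
    simp only [Set.mem_ofPred_eq, backslashCovers_iff]
    refine and_congr_right fun h => ?_
    rw [h.inf_le_iff le_top, top_inf_eq]
    simp

lemma covers_dualAnnihilator_iff [FiniteDimensional F V] {u v : Submodule F V} :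
    Covers v.dualAnnihilator u.dualAnnihilator ↔ Covers u v := by
  have h1 := Subspace.finrank_add_finrank_dualAnnihilator_eq u
  have h2 := Subspace.finrank_add_finrank_dualAnnihilator_eq v
  refine and_congr Subspace.dualAnnihilator_le_dualAnnihilator_iff ?_
  omega

lemma ncard_slashCovers_eq_ncard_dual [FiniteDimensional F V] (y u : Submodule F V) :
    ({a | SlashCovers y a u} : Set (Submodule F V)).ncard =
      ({w | Covers u.dualAnnihilator w ∧ w ≤ ⊤ ∧ ¬ w ≤ (u ⊓ y).dualAnnihilator} :
        Set (Submodule F (Module.Dual F V))).ncard := by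
  rw [← Set.ncard_image_of_injective (f := Submodule.dualAnnihilator) _
    fun _ _ => Subspace.dualAnnihilator_inj.mp]
  congr 1
  ext w
  simp only [Set.mem_image, Set.mem_ofPred_eq, slashCovers_iff]
  constructor
  · rintro ⟨a, ⟨h1, h2⟩, rfl⟩
    exact ⟨covers_dualAnnihilator_iff.mpr h1, le_top,
      fun h => h2 (Subspace.dualAnnihilator_le_dualAnnihilator_iff.mp h)⟩
  · rintro ⟨h1, -, h2⟩
    have hw := Subspace.dualCoannihilator_dualAnnihilator_eq (W := w)
    rw [← hw] at h1 h2
    exact ⟨w.dualCoannihilator, ⟨covers_dualAnnihilator_iff.mp h1,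
      fun h => h2 (Subspace.dualAnnihilator_le_dualAnnihilator_iff.mpr h)⟩, hw⟩

lemma ncard_slashCovers_mul [Fintype F] [FiniteDimensional F V] (y u : Submodule F V) :
    ((({a | SlashCovers y a u} : Set (Submodule F V)).ncard : ℕ) : ℂ) *
      ((Fintype.card F : ℂ) - 1) =
      qpow (Fintype.card F) (Module.finrank F ↥u : ℝ) -
        qpow (Fintype.card F) ((Module.finrank F ↥u : ℝ) - Module.finrank F ↥(u ⊓ y)) := by
  have hq : 1 < Fintype.card F := Fintype.one_lt_card
  have h1 := ncard_covers_not_le (Subspace.dualAnnihilator_le_dualAnnihilator_iff.mpr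
    (inf_le_left : u ⊓ y ≤ u)) le_top
  rw [← ncard_slashCovers_eq_ncard_dual, finrank_top, Subspace.dual_finrank_eq] at h1
  have h2 := Subspace.finrank_add_finrank_dualAnnihilator_eq u
  have h2' := Subspace.finrank_add_finrank_dualAnnihilator_eq (u ⊓ y)
  have h3 := congrArg (Nat.cast : ℕ → ℂ) h1
  rw [Nat.cast_mul, Nat.cast_sub (Nat.pow_le_pow_right hq.le (Nat.le_add_right _ 1)),
    Nat.cast_sub (Nat.pow_le_pow_right hq.le (by omega))] at h3
  push_cast at h3
  have h4 : (Module.finrank F ↥u : ℝ) + Module.finrank F ↥u.dualAnnihilator =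
      Module.finrank F V := by exact_mod_cast h2
  have h4' : (Module.finrank F ↥u : ℝ) - Module.finrank F ↥(u ⊓ y) +
      Module.finrank F ↥u.dualAnnihilator = Module.finrank F ↥(u ⊓ y).dualAnnihilator := by
    have : (Module.finrank F ↥(u ⊓ y) : ℝ) + Module.finrank F ↥(u ⊓ y).dualAnnihilator =
      Module.finrank F V := by exact_mod_cast h2'
    linarith
  have h5 : (Fintype.card F : ℂ) ^ Module.finrank F ↥u.dualAnnihilator ≠ 0 :=
    pow_ne_zero _ (Nat.cast_ne_zero.mpr (by omega))
  refine mul_right_cancel₀ h5 ?_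
  rw [sub_mul (qpow _ _), ← qpow_natCast, ← qpow_add (by omega), ← qpow_add (by omega),
    h4, h4', qpow_natCast, qpow_natCast, qpow_natCast, ← h3]
  ring

lemma matK1_inv [Fintype (Submodule F V)] {q : ℕ} (hq : 0 < q) (k : ℕ) (y : Submodule F V) :
    (matK1 q k y)⁻¹ = Matrix.diagonal fun u : Submodule F V =>
      qpow q (-((k : ℝ) / 2 - (Module.finrank F ↥(u ⊓ y) : ℝ))) := by
  refine Matrix.inv_eq_right_inv ?_
  rw [matK1, Matrix.diagonal_mul_diagonal, ← Matrix.diagonal_one]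
  congr 1
  ext u
  rw [← qpow_add hq, add_neg_cancel, qpow_zero]

lemma matK2_inv [Fintype (Submodule F V)] {q : ℕ} (hq : 0 < q) (n k : ℕ) (y : Submodule F V) :
    (matK2 q n k y)⁻¹ = Matrix.diagonal fun u : Submodule F V =>
      qpow q (-(((Module.finrank F ↥u : ℝ) - (Module.finrank F ↥(u ⊓ y) : ℝ))
        - ((n : ℝ) - (k : ℝ)) / 2)) := by
  refine Matrix.inv_eq_right_inv ?_
  rw [matK2, Matrix.diagonal_mul_diagonal, ← Matrix.diagonal_one]
  congr 1
  ext u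
  rw [← qpow_add hq, add_neg_cancel, qpow_zero]

/-- `F+` commutes with diagonal matrices that are constant on each `P_{i,j}`. -/
lemma matFp_mul_diagonal [Fintype (Submodule F V)] (y : Submodule F V) (d : Submodule F V → ℂ)
    (hd : ∀ u v : Submodule F V, Module.finrank F ↥u = Module.finrank F ↥v →
      Module.finrank F ↥(u ⊓ y) = Module.finrank F ↥(v ⊓ y) → d u = d v) :
    matFp y * Matrix.diagonal d = Matrix.diagonal d * matFp y := by
  ext u v
  rw [Matrix.mul_diagonal, Matrix.diagonal_mul, matFp, Matrix.of_apply]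
  split_ifs with h
  · obtain ⟨⟨h1, h2⟩, h3, h4⟩ := h
    have h5 := h1.2
    have h6 := h3.2
    rw [hd u v (by omega) (by omega), one_mul, mul_one]
  · rw [zero_mul, mul_zero]

theorem statement6
    (q n k : ℕ) (hq : IsPrimePow q) (hkn : k < n) (hk : 1 ≤ k)
    (F V : Type) [Field F] [Fintype F] (hcard : Fintype.card F = q)
    [AddCommGroup V] [Module F V] [FiniteDimensional F V]
    (hdim : Module.finrank F V = n)
    [Fintype (Submodule F V)]
    (y : Submodule F V) (hy : Module.finrank F ↥y = k) :
    matL y * matR y =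
      (q : ℂ) • (matFp y * matFm y) +
      ((q : ℂ) - 1)⁻¹ • ((qpow q ((n : ℝ) / 2 + 1) • ((matK1 q k y)⁻¹ * matK2 q n k y)
          - qpow q (((n : ℝ) - (k : ℝ)) / 2 + 1) • matK2 q n k y) * matFp y
        + (qpow q ((n : ℝ) / 2 + 1) • (matK1 q k y * (matK2 q n k y)⁻¹)
          - qpow q ((k : ℝ) / 2 + 1) • matK1 q k y) * matFm y) +
      (((q : ℂ) - 1)⁻¹) ^ 2 • (qpow q ((n : ℝ) / 2 + 1) • (matK1 q k y * matK2 q n k y)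
        - qpow q ((n : ℝ) - (k : ℝ) / 2 + 1) • matK1 q k y
        - qpow q (((n : ℝ) + (k : ℝ)) / 2 + 1) • matK2 q n k y
        + (q : ℂ) ^ (n + 1) • (1 : Matrix (Submodule F V) (Submodule F V) ℂ)) := by
  have hq1 : 1 < q := hcard ▸ Fintype.one_lt_card
  have hq0 : 0 < q := by omega
  have hqc : (q : ℂ) - 1 ≠ 0 := sub_ne_zero.mpr (Nat.cast_ne_one.mpr (by omega))
  have hP : ∀ u : Submodule F V,
      ((({b | BackslashCovers y u b} : Set (Submodule F V)).ncard : ℕ) : ℂ) =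
        ((q : ℂ) - 1)⁻¹ * (qpow q ((n : ℝ) - Module.finrank F ↥u) -
          qpow q ((k : ℝ) - Module.finrank F ↥(u ⊓ y))) := by
    intro u
    rw [eq_inv_mul_iff_mul_eq₀ hqc, mul_comm]
    subst hcard hdim hy
    exact ncard_backslashCovers_mul y u
  have hM : ∀ u : Submodule F V,
      ((({a | SlashCovers y a u} : Set (Submodule F V)).ncard : ℕ) : ℂ) =
        ((q : ℂ) - 1)⁻¹ * (qpow q (Module.finrank F ↥u : ℝ) -
          qpow q ((Module.finrank F ↥u : ℝ) - Module.finrank F ↥(u ⊓ y))) := by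
    intro u
    rw [eq_inv_mul_iff_mul_eq₀ hqc, mul_comm]
    subst hcard
    exact ncard_slashCovers_mul y u
  rw [matL_mul_matR, matL2_mul_matR2, matR1_mul_matL1, hcard, add_mul, mul_add, mul_add,
    matFp_mul_diagonal y _ fun u v h1 h2 => by rw [hM, hM, h1, h2]]
  simp only [hP, hM]
  have hmul : ∀ e : ℝ, (q : ℂ) * qpow q e = qpow q (e + 1) := fun e => by
    rw [qpow_add hq0, mul_comm]
    simp [qpow]
  have hqn : (q : ℂ) ^ (n + 1) = qpow q ((n : ℝ) + 1) := by
    rw [← qpow_natCast]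
    push_cast
    rfl
  have hdM : (q : ℂ) • (Matrix.diagonal fun u : Submodule F V =>
        ((q : ℂ) - 1)⁻¹ * (qpow q (Module.finrank F ↥u : ℝ) -
          qpow q ((Module.finrank F ↥u : ℝ) - Module.finrank F ↥(u ⊓ y)))) =
      ((q : ℂ) - 1)⁻¹ • (qpow q ((n : ℝ) / 2 + 1) • ((matK1 q k y)⁻¹ * matK2 q n k y)
          - qpow q (((n : ℝ) - (k : ℝ)) / 2 + 1) • matK2 q n k y) := by
    rw [matK1_inv hq0, matK2, Matrix.diagonal_mul_diagonal]
    simp only [← Matrix.diagonal_smul, Matrix.diagonal_sub]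
    congr 1
    ext u
    simp only [Pi.smul_apply, smul_eq_mul, ← qpow_add hq0]
    rw [mul_left_comm, mul_sub (q : ℂ), hmul, hmul]
    congr 3 <;> ring
  have hdP : (q : ℂ) • (Matrix.diagonal fun u : Submodule F V =>
        ((q : ℂ) - 1)⁻¹ * (qpow q ((n : ℝ) - Module.finrank F ↥u) -
          qpow q ((k : ℝ) - Module.finrank F ↥(u ⊓ y)))) =
      ((q : ℂ) - 1)⁻¹ • (qpow q ((n : ℝ) / 2 + 1) • (matK1 q k y * (matK2 q n k y)⁻¹)
          - qpow q ((k : ℝ) / 2 + 1) • matK1 q k y) := by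
    rw [matK2_inv hq0, matK1, Matrix.diagonal_mul_diagonal]
    simp only [← Matrix.diagonal_smul, Matrix.diagonal_sub]
    congr 1
    ext u
    simp only [Pi.smul_apply, smul_eq_mul, ← qpow_add hq0]
    rw [mul_left_comm, mul_sub (q : ℂ), hmul, hmul]
    congr 3 <;> ring
  have hdPM : (q : ℂ) • ((Matrix.diagonal fun u : Submodule F V =>
        ((q : ℂ) - 1)⁻¹ * (qpow q ((n : ℝ) - Module.finrank F ↥u) -
          qpow q ((k : ℝ) - Module.finrank F ↥(u ⊓ y)))) *
      Matrix.diagonal fun u : Submodule F V =>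
        ((q : ℂ) - 1)⁻¹ * (qpow q (Module.finrank F ↥u : ℝ) -
          qpow q ((Module.finrank F ↥u : ℝ) - Module.finrank F ↥(u ⊓ y)))) =
      (((q : ℂ) - 1)⁻¹) ^ 2 • (qpow q ((n : ℝ) / 2 + 1) • (matK1 q k y * matK2 q n k y)
        - qpow q ((n : ℝ) - (k : ℝ) / 2 + 1) • matK1 q k y
        - qpow q (((n : ℝ) + (k : ℝ)) / 2 + 1) • matK2 q n k y
        + (q : ℂ) ^ (n + 1) • (1 : Matrix (Submodule F V) (Submodule F V) ℂ)) := by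
    rw [matK1, matK2, Matrix.diagonal_mul_diagonal, Matrix.diagonal_mul_diagonal,
      ← Matrix.diagonal_one, hqn]
    simp only [← Matrix.diagonal_smul, Matrix.diagonal_sub, Matrix.diagonal_add]
    congr 1
    ext u
    simp only [Pi.smul_apply, smul_eq_mul, ← qpow_add hq0, mul_one]
    have hexp : ∀ a b c d : ℂ,
        (q : ℂ) * (((q : ℂ) - 1)⁻¹ * (a - b) * (((q : ℂ) - 1)⁻¹ * (c - d)))
        = (((q : ℂ) - 1)⁻¹) ^ 2 * (q * (b * d) - q * (a * d) - q * (b * c) + q * (a * c)) := by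
      intros
      ring
    rw [hexp]
    congr 1
    simp only [← qpow_add hq0, hmul]
    congr 1
    · congr 1
      · congr 1 <;> congr 1 <;> ring
      · congr 1; ring
    · congr 1; ring
  rw [← hdPM, smul_add (((q : ℂ) - 1)⁻¹), ← Matrix.smul_mul (((q : ℂ) - 1)⁻¹),
    ← Matrix.smul_mul (((q : ℂ) - 1)⁻¹), ← hdM, ← hdP]
  simp only [smul_add, Matrix.smul_mul]
  abel
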